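/- The sum over k >= 0 of (H_{2k} - H_k) * (-1)^k * k / ((3k+1) * binomial(3k,k) * 4^{k+1}) equals (3/448)·ln 2 - (9/512)·(ln 2)² - (3/128)·arctan²(√7/5) - ((1/224) - (89/6272)·ln 2)·√7·arctan(√7/5). -/

import Mathlib

open Real

noncomputable def ell (x : ℝ) : ℝ := Real.log x - Real.log (1 - x)

lemma ell_int : IntervalIntegrable ell MeasureTheory.volume 0 1 := by
  have h1 : IntervalIntegrable Real.log MeasureTheory.volume 0 1 :=
    intervalIntegral.intervalIntegrable_log'
  have h2 := (h1.comp_sub_left 1)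
  simp only [sub_zero, sub_self] at h2
  exact h1.sub h2.symm

lemma mul_cont {f : ℝ → ℝ} (hf : Continuous f) :
    IntervalIntegrable (fun x => f x * ell x) MeasureTheory.volume 0 1 :=
  ell_int.continuousOn_mul hf.continuousOn

lemma ell_deriv {x : ℝ} (hx : x ∈ Set.Ioo (0:ℝ) 1) : HasDerivAt ell (1 / x + 1 / (1 - x)) x := by
  have h1 := Real.hasDerivAt_log hx.1.ne'
  have h2 := ((hasDerivAt_id x).const_sub 1).log (by simp; linarith [hx.2])
  refine (h1.sub h2).congr_deriv ?_
  simp; ring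

noncomputable def J (m n : ℕ) : ℝ := ∫ x in (0:ℝ)..1, (x ^ m * (1 - x) ^ n) * ell x
noncomputable def Be (m n : ℕ) : ℝ := ∫ x in (0:ℝ)..1, (x ^ m * (1 - x) ^ n)

lemma J_add (m n : ℕ) : J m (n+1) + J (m+1) n = J m n := by
  unfold J
  rw [← intervalIntegral.integral_add (mul_cont (by fun_prop)) (mul_cont (by fun_prop))]
  congr 1; ext x; ring

lemma Be_add (m n : ℕ) : Be m (n+1) + Be (m+1) n = Be m n := by
  unfold Be
  rw [← intervalIntegral.integral_add (Continuous.intervalIntegrable (by fun_prop) _ _)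
    (Continuous.intervalIntegrable (by fun_prop) _ _)]
  congr 1; ext x; ring

lemma Be_rec (m n : ℕ) : (m+1) * Be m (n+1) - (n+1) * Be (m+1) n = 0 := by
  have key := intervalIntegral.integral_eq_sub_of_hasDerivAt (a := 0) (b := 1)
    (f := fun x : ℝ => x^(m+1) * (1-x)^(n+1))
    (f' := fun x => (m+1) * (x^m * (1-x)^(n+1)) - (n+1) * (x^(m+1) * (1-x)^n))
    (fun x _ => by
      have h1 := (hasDerivAt_pow (m+1) x).mul (((hasDerivAt_id x).const_sub 1).pow (n+1))
      refine h1.congr_deriv ?_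
      simp; ring) (Continuous.intervalIntegrable (by fun_prop) _ _)
  rw [intervalIntegral.integral_sub (Continuous.intervalIntegrable (by fun_prop) _ _)
    (Continuous.intervalIntegrable (by fun_prop) _ _),
    intervalIntegral.integral_const_mul, intervalIntegral.integral_const_mul] at key
  simpa [Be] using key

lemma J_rec (m n : ℕ) : (m+1) * J m (n+1) - (n+1) * J (m+1) n + Be m n = 0 := by
  have e : ∀ x : ℝ, x^(m+1) * (1-x)^(n+1) * ell x =
      x^m * (1-x)^(n+1) * (x * Real.log x) - x^(m+1)*(1-x)^n * ((1-x) * Real.log (1-x)) := by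
    intro x; unfold ell; ring
  have hi1 : IntervalIntegrable (fun x : ℝ => (m+1) * (x^m * (1-x)^(n+1) * ell x)) MeasureTheory.volume 0 1 :=
    (mul_cont (by fun_prop)).const_mul _
  have hi2 : IntervalIntegrable (fun x : ℝ => (n+1) * (x^(m+1) * (1-x)^n * ell x)) MeasureTheory.volume 0 1 :=
    (mul_cont (by fun_prop)).const_mul _
  have hi3 : IntervalIntegrable (fun x : ℝ => (x^m * (1-x)^n)) MeasureTheory.volume 0 1 :=
    (Continuous.intervalIntegrable (by fun_prop) _ _)
  have key := intervalIntegral.integral_eq_sub_of_hasDerivAt_of_le (a := 0) (b := 1) zero_le_one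
    (f := fun x : ℝ => x^(m+1) * (1-x)^(n+1) * ell x)
    (f' := fun x => (m+1) * (x^m * (1-x)^(n+1) * ell x) - (n+1) * (x^(m+1) * (1-x)^n * ell x)
      + x^m * (1-x)^n)
    (by
      simp only [e]
      have h1 := Real.continuous_mul_log
      have h2 : Continuous (fun x : ℝ => (1-x) * Real.log (1-x)) :=
        h1.comp (continuous_const.sub continuous_id)
      apply Continuous.continuousOn
      fun_prop)
    (fun x hx => by
      have h1 := ((hasDerivAt_pow (m+1) x).mul (((hasDerivAt_id x).const_sub 1).pow (n+1))).mul
        (ell_deriv hx)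
      refine h1.congr_deriv ?_
      have := hx.1.ne'
      have h3 : 1 - x ≠ 0 := by linarith [hx.2]
      simp
      field_simp
      ring) ((hi1.sub hi2).add hi3)
  rw [intervalIntegral.integral_add (hi1.sub hi2) hi3, intervalIntegral.integral_sub hi1 hi2,
    intervalIntegral.integral_const_mul, intervalIntegral.integral_const_mul] at key
  simpa [Be, J] using key

lemma J00 : J 0 0 = 0 := by
  have h1 : ∫ x in (0:ℝ)..1, Real.log (1 - x) = ∫ x in (0:ℝ)..1, Real.log x := by
    simp
  unfold J ell
  simp only [pow_zero, one_mul]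
  have hi : IntervalIntegrable Real.log MeasureTheory.volume 0 1 :=
    intervalIntegral.intervalIntegrable_log'
  have h2 := (hi.comp_sub_left 1)
  simp only [sub_zero, sub_self] at h2
  rw [intervalIntegral.integral_sub hi h2.symm, h1, sub_self]

lemma Be_val : ∀ N m n : ℕ, m + n = N → Be m n * (m+n+1).factorial = m.factorial * n.factorial := by
  intro N
  induction N with
  | zero =>
    intro m n h
    obtain ⟨rfl, rfl⟩ : m = 0 ∧ n = 0 := by omega
    simp [Be]
  | succ N ih =>
    intro m n h
    rcases m with _ | m
    · obtain ⟨n, rfl⟩ : ∃ k, n = k + 1 := ⟨n - 1, by omega⟩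
      have h1 := Be_add 0 n
      have h2 := Be_rec 0 n
      have h3 := ih 0 n (by omega)
      have h4 : Be 0 (n+1) * (n+2) = (n+1) * Be 0 n := by
        push_cast at h2; linear_combination (n+1) * h1 + h2
      simp only [zero_add, Nat.factorial_succ n, Nat.factorial_succ (n+1), Nat.factorial_zero] at h3 ⊢
      push_cast at h3 ⊢
      linear_combination (n+1) * (n.factorial:ℝ) * h4 + (n+1) * h3
    · have h1 := Be_add m n
      have h2 := Be_rec m n
      have h3 := ih m n (by omega)
      have h4 : Be (m+1) n * (m+n+2) = (m+1) * Be m n := by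
        linear_combination (m+1) * h1 - h2
      rw [show m + 1 + n + 1 = (m + n + 1) + 1 by ring, Nat.factorial_succ (m+n+1), Nat.factorial_succ m]
      push_cast at h3 ⊢
      linear_combination ((m+n+1).factorial:ℝ) * h4 + (m+1) * h3

lemma J_val : ∀ N m n : ℕ, m + n = N → J m n = Be m n * ((harmonic m : ℝ) - harmonic n) := by
  intro N
  induction N with
  | zero =>
    intro m n h
    obtain ⟨rfl, rfl⟩ : m = 0 ∧ n = 0 := by omega
    simp [J00]
  | succ N ih =>
    intro m n h
    rcases m with _ | m
    · obtain ⟨n, rfl⟩ : ∃ k, n = k + 1 := ⟨n - 1, by omega⟩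
      have h1 := Be_add 0 n
      have h2 := Be_rec 0 n
      have h3 := ih 0 n (by omega)
      have h1' := J_add 0 n
      have h2' := J_rec 0 n
      rw [harmonic_succ]
      simp only [harmonic_zero] at h3 ⊢
      push_cast at h1 h2 h3 h1' h2' ⊢
      have p : (n:ℝ) + 2 ≠ 0 := by positivity
      have p' : (n:ℝ) + 1 ≠ 0 := by positivity
      have h4 : Be 0 (n+1) = (n+1) * Be 0 n / (n+2) := by
        field_simp; linear_combination (n+1) * h1 + h2
      have h5 : J 0 (n+1) = ((n+1) * J 0 n - Be 0 n) / (n+2) := by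
        field_simp; linear_combination (n+1) * h1' + h2'
      rw [h5, h4, h3]
      field_simp
      ring
    · have h1 := Be_add m n
      have h2 := Be_rec m n
      have h3 := ih m n (by omega)
      have h1' := J_add m n
      have h2' := J_rec m n
      rw [harmonic_succ]
      push_cast at h1 h2 h3 h1' h2' ⊢
      have p : (m:ℝ) + n + 2 ≠ 0 := by positivity
      have p' : (m:ℝ) + 1 ≠ 0 := by positivity
      have h4 : Be (m+1) n = (m+1) * Be m n / (m+n+2) := by
        field_simp; linear_combination (m+1) * h1 - h2
      have h5 : J (m+1) n = ((m+1) * J m n + Be m n) / (m+n+2) := by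
        field_simp; linear_combination (m+1) * h1' - h2'
      rw [h5, h4, h3]
      field_simp
      ring

lemma J_main (k : ℕ) : J (2*k) k =
    ((harmonic (2 * k) : ℝ) - (harmonic k : ℝ)) / ((3 * k + 1) * (Nat.choose (3 * k) k : ℝ)) := by
  rw [J_val _ _ _ rfl]
  have h := Be_val _ (2*k) k rfl
  have h2 := Nat.choose_mul_factorial_mul_factorial (show k ≤ 3*k by omega)
  rw [show 3*k - k = 2*k by omega] at h2
  rw [show 2*k+k+1 = 3*k+1 by ring, Nat.factorial_succ, ← h2] at h
  have p := Nat.factorial_pos k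
  have p2 := Nat.factorial_pos (2*k)
  have p3 : 0 < Nat.choose (3*k) k := Nat.choose_pos (by omega)
  push_cast at h
  have : Be (2*k) k * ((3 * k + 1) * (Nat.choose (3 * k) k : ℝ)) = 1 := by
    have q : ((2*k).factorial : ℝ) * k.factorial ≠ 0 := by positivity
    apply mul_right_cancel₀ q
    linear_combination h
  rw [eq_div_iff (by positivity)]
  linear_combination ((harmonic (2 * k) : ℝ) - (harmonic k : ℝ)) * this

/-- The sum as an integral. -/
lemma sum_eq :
    ∑' k : ℕ, ((harmonic (2 * k) : ℝ) - (harmonic k : ℝ)) * (-1) ^ k * k /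
        ((3 * k + 1) * (Nat.choose (3 * k) k : ℝ) * 4 ^ (k + 1)) =
    ∫ x in (0:ℝ)..1, (4 / (4 + x^2 - x^3)^2 - 1 / (4 + x^2 - x^3)) * ell x := by
  have hs : HasSum (fun k : ℕ => ∫ x in (0:ℝ)..1, (k * (-(x^2*(1-x)/4))^k / 4) * ell x)
      (∫ x in (0:ℝ)..1, (4 / (4 + x^2 - x^3)^2 - 1 / (4 + x^2 - x^3)) * ell x) := by
    have hz : ∀ x ∈ Set.uIoc (0:ℝ) 1, |(-(x^2*(1-x)/4))| ≤ 1/4 := by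
      intro x hx
      rw [Set.uIoc_of_le zero_le_one] at hx
      rw [abs_neg, abs_of_nonneg]
      · have : x^2 ≤ 1 := by nlinarith [hx.1, hx.2]
        nlinarith [hx.1, hx.2]
      · have := hx.2
        have : 0 ≤ 1 - x := by linarith
        positivity
    apply intervalIntegral.hasSum_integral_of_dominated_convergence
      (fun (k : ℕ) (x : ℝ) => (k * (1/4:ℝ)^k) * |ell x|)
    · intro k
      exact (mul_cont (by fun_prop)).def'.aestronglyMeasurable
    · intro k
      filter_upwards with x hx
      have := hz x hx
      rw [norm_mul, Real.norm_eq_abs, Real.norm_eq_abs, abs_div, abs_mul, abs_pow]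
      gcongr
      rw [Nat.abs_cast]
      refine (div_le_self (by positivity) (by norm_num)).trans ?_
      gcongr
    · filter_upwards with x hx
      apply Summable.mul_right
      simpa using summable_pow_mul_geometric_of_norm_lt_one 1 (r := (1/4:ℝ)) (by norm_num)
    · simp only [tsum_mul_right]
      exact ell_int.abs.const_mul _
    · filter_upwards with x hx
      apply HasSum.mul_right
      have h := hasSum_coe_mul_geometric_of_norm_lt_one (r := (-(x^2*(1-x)/4)))
        (by rw [Real.norm_eq_abs]; linarith [hz x hx])
      have h' := h.div_const 4
      suffices hh : (4 / (4 + x^2 - x^3)^2 - 1 / (4 + x^2 - x^3)) =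
          -(x^2*(1-x)/4) / (1 - -(x^2*(1-x)/4))^2 / 4 by
        rw [hh]; exact h'
      have h1 := (abs_le.1 (hz x hx)).2
      have : 4 + x^2 - x^3 ≠ 0 := by nlinarith
      have : 1 - -(x^2*(1-x)/4) = (4 + x^2 - x^3) / 4 := by ring
      rw [this]
      field_simp
      ring
  rw [← hs.tsum_eq]
  congr 1; ext k
  have : ∀ x : ℝ, (k * (-(x^2*(1-x)/4))^k / 4) * ell x =
     (k * (-1)^k / 4^(k+1)) * ((x^(2*k) * (1-x)^k) * ell x) := by
    intro x
    rw [neg_pow, div_pow, mul_pow, pow_mul, pow_succ (4:ℝ)]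
    field_simp
  simp only [this]
  rw [intervalIntegral.integral_const_mul]
  change _ = _ * J (2*k) k
  rw [J_main]
  have p3 : 0 < Nat.choose (3*k) k := Nat.choose_pos (by omega)
  field_simp

lemma ellC_int : IntervalIntegrable (fun x => (ell x : ℂ)) MeasureTheory.volume 0 1 :=
  ⟨ell_int.1.ofReal, ell_int.2.ofReal⟩

lemma norm_low {c : ℂ} {r : ℝ} (hr : r < 1) (hc : ‖c‖ ≤ r) {x : ℝ} (hx : x ∈ Set.Icc (0:ℝ) 1) :
    1 - r ≤ ‖1 - c * x‖ := by
  have h1 : ‖c * (x:ℂ)‖ ≤ r := by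
    rw [norm_mul, Complex.norm_real, Real.norm_eq_abs, abs_of_nonneg hx.1]
    nlinarith [hx.1, hx.2, norm_nonneg c]
  have := norm_sub_norm_le (1:ℂ) (c * x)
  rw [norm_one] at this
  linarith

lemma ne_low {c : ℂ} (hc : ‖c‖ < 1) {x : ℝ} (hx : x ∈ Set.Icc (0:ℝ) 1) : 1 - c * (x:ℂ) ≠ 0 := by
  have := norm_low hc le_rfl hx
  intro h
  rw [h, norm_zero] at this
  linarith

lemma slit_low {c : ℂ} (hc : ‖c‖ < 1) {x : ℝ} (hx : x ∈ Set.Icc (0:ℝ) 1) :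
    1 - c * (x:ℂ) ∈ Complex.slitPlane := by
  left
  have h1 : ‖c * (x:ℂ)‖ < 1 := by
    rw [norm_mul, Complex.norm_real, Real.norm_eq_abs, abs_of_nonneg hx.1]
    nlinarith [hx.1, hx.2, norm_nonneg c]
  have := Complex.re_le_norm (c * (x:ℂ))
  simp only [Complex.sub_re, Complex.one_re]
  linarith

lemma cont1 {c : ℂ} (hc : ‖c‖ < 1) : ContinuousOn (fun x : ℝ => 1 / (1 - c * (x:ℂ))) (Set.uIcc 0 1) := by
  rw [Set.uIcc_of_le zero_le_one]
  apply ContinuousOn.div continuousOn_const (Continuous.continuousOn (by fun_prop))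
  intro x hx
  exact ne_low hc hx

lemma cont2 {c : ℂ} (hc : ‖c‖ < 1) : ContinuousOn (fun x : ℝ => 1 / (1 - c * (x:ℂ))^2) (Set.uIcc 0 1) := by
  rw [Set.uIcc_of_le zero_le_one]
  apply ContinuousOn.div continuousOn_const (Continuous.continuousOn (by fun_prop))
  intro x hx
  exact pow_ne_zero _ (ne_low hc hx)

lemma int1 {c : ℂ} (hc : ‖c‖ < 1) :
    IntervalIntegrable (fun x : ℝ => 1 / (1 - c * (x:ℂ)) * (ell x : ℂ)) MeasureTheory.volume 0 1 :=
  ellC_int.continuousOn_mul (cont1 hc)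

lemma int2 {c : ℂ} (hc : ‖c‖ < 1) :
    IntervalIntegrable (fun x : ℝ => 1 / (1 - c * (x:ℂ))^2 * (ell x : ℂ)) MeasureTheory.volume 0 1 :=
  ellC_int.continuousOn_mul (cont2 hc)

lemma I2 {c : ℂ} (hc : ‖c‖ < 1) :
    ∫ x in (0:ℝ)..1, 1 / (1 - c * (x:ℂ))^2 * (ell x : ℂ) = - Complex.log (1 - c) / (1 - c) := by
  have h1c : 1 - c ≠ 0 := by simpa using ne_low hc (x := 1) (by simp)
  have key := intervalIntegral.integral_eq_sub_of_hasDerivAt_of_le (a := 0) (b := 1) zero_le_one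
    (f := fun x : ℝ => 1 / (1 - c * (x:ℂ)) * ((x * Real.log x : ℝ) : ℂ)
       + 1 / (1 - c * (x:ℂ)) * (((1 - x) * Real.log (1 - x) : ℝ) : ℂ) / (1 - c)
       - Complex.log (1 - c * (x:ℂ)) / (1 - c))
    (f' := fun x : ℝ => 1 / (1 - c * (x:ℂ))^2 * (ell x : ℂ))
    (by
      have h0 := cont1 hc
      rw [Set.uIcc_of_le zero_le_one] at h0
      have h1 : Continuous (fun x : ℝ => ((x * Real.log x : ℝ) : ℂ)) :=
        Complex.continuous_ofReal.comp Real.continuous_mul_log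
      have h2 : Continuous (fun x : ℝ => (((1-x) * Real.log (1-x) : ℝ) : ℂ)) :=
        h1.comp (continuous_const.sub continuous_id)
      refine ((h0.mul h1.continuousOn).add ((h0.mul h2.continuousOn).div_const _)).sub
        (ContinuousOn.div_const (ContinuousOn.clog (Continuous.continuousOn (by fun_prop)) ?_) _)
      intro x hx
      exact slit_low hc hx)
    (fun x hx => by
      have hx' : x ∈ Set.Icc (0:ℝ) 1 := ⟨hx.1.le, hx.2.le⟩
      have hne := ne_low hc hx'
      have d0 : HasDerivAt (fun x : ℝ => 1 - c * (x:ℂ)) (-(c * 1)) x :=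
        ((hasDerivAt_id x).ofReal_comp.const_mul c).const_sub 1
      have d1 : HasDerivAt (fun x : ℝ => 1 / (1 - c * (x:ℂ))) (c / (1 - c * x)^2) x := by
        have h := d0.inv hne
        simp only [one_div]
        exact h.congr_deriv (by simp)
      have dl := d0.clog_real (slit_low hc hx')
      have x0 := hx.1.ne'
      have x1 : 1 - x ≠ 0 := by linarith [hx.2]
      have d2 : HasDerivAt (fun x : ℝ => ((x * Real.log x : ℝ) : ℂ)) ((Real.log x + 1 : ℝ) : ℂ) x :=
        (Real.hasDerivAt_mul_log x0).ofReal_comp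
      have d3 : HasDerivAt (fun x : ℝ => (((1-x) * Real.log (1-x) : ℝ) : ℂ))
          ((-(Real.log (1-x) + 1) : ℝ) : ℂ) x := by
        have := ((Real.hasDerivAt_mul_log x1).comp x ((hasDerivAt_id x).const_sub 1)).ofReal_comp
        refine this.congr_deriv ?_
        simp
      have := ((d1.mul d2).add ((d1.mul d3).div_const (1-c))).sub (dl.div_const (1-c))
      refine this.congr_deriv ?_
      unfold ell
      push_cast
      field_simp
      ring)
    (int2 hc)
  rw [key]
  simp
  ring

noncomputable def M (c : ℂ) : ℂ := ∫ x in (0:ℝ)..1, c * (1 / (1 - c * (x:ℂ)) * (ell x : ℂ))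

lemma M_deriv {c : ℂ} (hc : ‖c‖ < 1) : HasDerivAt M (- Complex.log (1 - c) / (1 - c)) c := by
  rw [← I2 hc]
  obtain ⟨r, h1, h2⟩ := exists_between hc
  have hs : {d : ℂ | ‖d‖ < r} ∈ nhds c := (isOpen_lt continuous_norm continuous_const).mem_nhds h1
  have hI : ∀ x ∈ Set.uIoc (0:ℝ) 1, x ∈ Set.Icc (0:ℝ) 1 := by
    intro x hx
    rw [Set.uIoc_of_le zero_le_one] at hx
    exact ⟨hx.1.le, hx.2⟩
  refine (intervalIntegral.hasDerivAt_integral_of_dominated_loc_of_deriv_le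
    (F := fun (c : ℂ) (x : ℝ) => c * (1 / (1 - c * (x:ℂ)) * (ell x : ℂ)))
    (F' := fun (c : ℂ) (x : ℝ) => 1 / (1 - c * (x:ℂ))^2 * (ell x : ℂ))
    (bound := fun x => 1 / (1 - r)^2 * |ell x|) hs ?_ ?_ ?_ ?_ ?_ ?_).2
  · filter_upwards [hs] with d hd
    exact ((int1 (lt_trans hd h2)).const_mul d).def'.aestronglyMeasurable
  · exact (int1 hc).const_mul c
  · exact (int2 hc).def'.aestronglyMeasurable
  · filter_upwards with x hx d hd
    rw [norm_mul, norm_div, norm_pow, norm_one, Complex.norm_real, Real.norm_eq_abs]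
    have := norm_low h2 (le_of_lt hd) (hI x hx)
    have : 0 < 1 - r := by linarith
    gcongr
  · exact ell_int.abs.const_mul _
  · filter_upwards with x hx d hd
    have hne := ne_low (lt_trans hd h2) (hI x hx)
    have d0 : HasDerivAt (fun d : ℂ => 1 - d * (x:ℂ)) (-(1 * (x:ℂ))) d :=
        ((hasDerivAt_id d).mul_const (x:ℂ)).const_sub 1
    have d1 : HasDerivAt (fun d : ℂ => 1 / (1 - d * (x:ℂ))) (x / (1 - d * x)^2) d := by
      have h := d0.inv hne
      simp only [one_div]
      exact h.congr_deriv (by simp)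
    have := (hasDerivAt_id d).mul (d1.mul_const (ell x : ℂ))
    refine this.congr_deriv ?_
    simp only [id]
    field_simp
    ring

lemma M_val {c : ℂ} (hc : ‖c‖ < 1) : M c = Complex.log (1 - c) ^ 2 / 2 := by
  have hd : ∀ d ∈ Metric.ball (0:ℂ) 1,
      HasDerivAt (fun d => M d - Complex.log (1 - d) ^ 2 / 2) 0 d := by
    intro d hd
    have hd : ‖d‖ < 1 := by simpa using hd
    have hsl := slit_low hd (x := 1) (by simp)
    have hne := ne_low hd (x := 1) (by simp)
    simp only [Complex.ofReal_one, mul_one] at hsl hne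
    have h1 := (((hasDerivAt_id d).const_sub 1).clog hsl).pow 2
    refine ((M_deriv hd).sub (h1.div_const 2)).congr_deriv ?_
    simp
    field_simp
    ring
  have := Metric.isOpen_ball.is_const_of_deriv_eq_zero (𝕜 := ℂ)
    (convex_ball (0:ℂ) 1).isPreconnected
    (fun d h => (hd d h).differentiableAt.differentiableWithinAt) (fun d h => (hd d h).deriv)
    (x := c) (y := 0) (by simpa using hc) (by simp)
  simp [M] at this
  unfold M
  simpa [sub_eq_zero] using this

lemma I1 {c : ℂ} (hc : ‖c‖ < 1) (h0 : c ≠ 0) :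
    ∫ x in (0:ℝ)..1, 1 / (1 - c * (x:ℂ)) * (ell x : ℂ) = Complex.log (1 - c) ^ 2 / 2 / c := by
  rw [← M_val hc, M, intervalIntegral.integral_const_mul]
  field_simp

lemma pf (w x : ℂ) (hw : w^2 = -7) (h0 : 1 - (1/2) * x ≠ 0) (h1 : 1 - (-1/4-w/4) * x ≠ 0)
    (h2 : 1 - (-1/4+w/4) * x ≠ 0) :
    4 / (4 + x^2 - x^3)^2 - 1 / (4 + x^2 - x^3) =
      -3/128 * (1 / (1 - (1/2) * x)) + 1/64 * (1 / (1 - (1/2) * x)^2)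
      + (-55/1792 - 29/12544 * w) * (1 / (1 - (-1/4-w/4) * x))
      + (31/896 + 3/896*w) * (1 / (1 - (-1/4-w/4) * x)^2)
      + (-55/1792 + 29/12544 * w) * (1 / (1 - (-1/4+w/4) * x))
      + (31/896 - 3/896*w) * (1 / (1 - (-1/4+w/4) * x)^2) := by
  have e : 4 + x^2 - x^3 = 4 * ((1 - (1/2) * x) * (1 - (-1/4-w/4) * x) * (1 - (-1/4+w/4) * x)) := by
    linear_combination (1/4*x^2 - 1/8*x^3) * hw
  rw [e]
  set a := 1 - (1/2) * x with ha
  set b := 1 - (-1/4-w/4) * x with hb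
  set d := 1 - (-1/4+w/4) * x with hd
  field_simp
  rw [ha, hb, hd]
  grind

lemma logs : Complex.log (1 - (-1/4 - (Complex.I * Real.sqrt 7)/4)) =
    Real.log 2 / 2 + Complex.I * Real.arctan (Real.sqrt 7 / 5) ∧
    Complex.log (1 - (-1/4 + (Complex.I * Real.sqrt 7)/4)) =
    Real.log 2 / 2 - Complex.I * Real.arctan (Real.sqrt 7 / 5) := by
  have h7 : Real.sqrt 7 ^ 2 = 7 := Real.sq_sqrt (by norm_num)
  have hnorm : ∀ z : ℂ, z.re = 5/4 → z.im^2 = 7/16 → Real.log ‖z‖ = Real.log 2 / 2 := by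
    intro z h1 h2
    have : ‖z‖ = Real.sqrt 2 := by
      rw [Complex.norm_def, Complex.normSq_apply, h1, ← pow_two, ← pow_two, h2]; norm_num
    rw [this, Real.log_sqrt (by norm_num)]
  have harg : ∀ z : ℂ, z.re = 5/4 → z.arg = Real.arctan (z.im / z.re) := by
    intro z h
    rw [← Complex.tan_arg, Real.arctan_tan]
    · exact (abs_lt.1 (Complex.abs_arg_lt_pi_div_two_iff.2 (Or.inl (by rw [h]; norm_num)))).1
    · exact (abs_lt.1 (Complex.abs_arg_lt_pi_div_two_iff.2 (Or.inl (by rw [h]; norm_num)))).2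
  constructor
  · have hre : (1 - (-1/4 - (Complex.I * Real.sqrt 7)/4) : ℂ).re = 5/4 := by simp; norm_num
    have him : (1 - (-1/4 - (Complex.I * Real.sqrt 7)/4) : ℂ).im = Real.sqrt 7 / 4 := by simp
    rw [Complex.log, hnorm _ hre (by rw [him, div_pow, h7]; norm_num), harg _ hre, hre, him,
      show Real.sqrt 7 / 4 / (5/4) = Real.sqrt 7 / 5 by ring]
    push_cast; ring
  · have hre : (1 - (-1/4 + (Complex.I * Real.sqrt 7)/4) : ℂ).re = 5/4 := by simp; norm_num
    have him : (1 - (-1/4 + (Complex.I * Real.sqrt 7)/4) : ℂ).im = -(Real.sqrt 7 / 4) := by simp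
    rw [Complex.log, hnorm _ hre (by rw [him, neg_sq, div_pow, h7]; norm_num), harg _ hre, hre, him,
      show -(Real.sqrt 7 / 4) / (5/4) = -(Real.sqrt 7 / 5) by ring, Real.arctan_neg]
    push_cast; ring

lemma final : ∫ x in (0:ℝ)..1, (4 / (4 + x^2 - x^3)^2 - 1 / (4 + x^2 - x^3)) * ell x =
      (3 / 448) * Real.log 2 - (9 / 512) * (Real.log 2) ^ 2 -
        (3 / 128) * (Real.arctan (Real.sqrt 7 / 5)) ^ 2 -
        ((1 / 224) - (89 / 6272) * Real.log 2) * Real.sqrt 7 *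
          Real.arctan (Real.sqrt 7 / 5) := by
  have h7 : ((Real.sqrt 7 : ℝ) : ℂ) ^ 2 = 7 := by
    rw [← Complex.ofReal_pow, Real.sq_sqrt (by norm_num)]; norm_num
  have h7r : Real.sqrt 7 ^ 2 = 7 := Real.sq_sqrt (by norm_num)
  obtain ⟨l1, l2⟩ := logs
  apply Complex.ofReal_injective
  rw [← intervalIntegral.integral_ofReal]
  obtain ⟨w, hwdef⟩ : ∃ w : ℂ, w = Complex.I * Real.sqrt 7 := ⟨_, rfl⟩
  rw [← hwdef] at l1 l2
  have hw : w^2 = -7 := by rw [hwdef, mul_pow, h7, Complex.I_sq]; ring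
  have n0 : ‖(1/2:ℂ)‖ < 1 := by norm_num
  have hn : ∀ z : ℂ, z.re = -1/4 → z.im^2 = 7/16 → ‖z‖ < 1 := by
    intro z h1 h2
    rw [Complex.norm_def, Complex.normSq_apply, h1, ← pow_two, ← pow_two, h2,
      Real.sqrt_lt' (by norm_num)]
    norm_num
  have n1 : ‖(-1/4 - w/4:ℂ)‖ < 1 := by
    apply hn
    · simp [hwdef]
    · simp [hwdef, div_pow, h7r]; norm_num
  have n2 : ‖(-1/4 + w/4:ℂ)‖ < 1 := by
    apply hn
    · simp [hwdef]
    · simp [hwdef, div_pow, h7r]; norm_num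
  have c1 : (-1/4 - w/4:ℂ) * (-1/4 + w/4:ℂ) = 1/2 := by linear_combination (-1/16) * hw
  have z1 : (-1/4 - w/4:ℂ) ≠ 0 := by intro h; rw [h] at c1; norm_num at c1
  have z2 : (-1/4 + w/4:ℂ) ≠ 0 := by intro h; rw [h] at c1; norm_num at c1
  have l0 : Complex.log (1 - 1/2) = -Real.log 2 := by
    rw [show (1 - 1/2 : ℂ) = ((1/2 : ℝ) : ℂ) by norm_num, ← Complex.ofReal_log (by norm_num)]
    rw [one_div, Real.log_inv]; simp
  have e : ∀ x ∈ Set.uIcc (0:ℝ) 1,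
      (((4 / (4 + x^2 - x^3)^2 - 1 / (4 + x^2 - x^3)) * ell x : ℝ) : ℂ) =
      -3/128 * (1 / (1 - (1/2) * (x:ℂ)) * (ell x : ℂ)) + 1/64 * (1 / (1 - (1/2) * (x:ℂ))^2 * (ell x : ℂ))
      + (-55/1792 - 29/12544 * w) * (1 / (1 - (-1/4-w/4) * (x:ℂ)) * (ell x : ℂ))
      + (31/896 + 3/896*w) * (1 / (1 - (-1/4-w/4) * (x:ℂ))^2 * (ell x : ℂ))
      + (-55/1792 + 29/12544 * w) * (1 / (1 - (-1/4+w/4) * (x:ℂ)) * (ell x : ℂ))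
      + (31/896 - 3/896*w) * (1 / (1 - (-1/4+w/4) * (x:ℂ))^2 * (ell x : ℂ)) := by
    intro x hx
    rw [Set.uIcc_of_le zero_le_one] at hx
    have := pf w x hw (ne_low n0 hx) (ne_low n1 hx) (ne_low n2 hx)
    push_cast
    rw [this]
    ring
  have i1 := (int1 n0).const_mul (-3/128)
  have i2 := (int2 n0).const_mul (1/64)
  have i3 := (int1 n1).const_mul (-55/1792 - 29/12544 * w)
  have i4 := (int2 n1).const_mul (31/896 + 3/896*w)
  have i5 := (int1 n2).const_mul (-55/1792 + 29/12544 * w)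
  have i6 := (int2 n2).const_mul (31/896 - 3/896*w)
  rw [intervalIntegral.integral_congr e,
    intervalIntegral.integral_add ((((i1.add i2).add i3).add i4).add i5) i6,
    intervalIntegral.integral_add (((i1.add i2).add i3).add i4) i5,
    intervalIntegral.integral_add ((i1.add i2).add i3) i4,
    intervalIntegral.integral_add (i1.add i2) i3,
    intervalIntegral.integral_add i1 i2]
  simp only [intervalIntegral.integral_const_mul]
  rw [I1 n0 (by norm_num), I1 n1 z1, I1 n2 z2, I2 n0, I2 n1, I2 n2, l0, l1, l2]
  have v1 : ∀ X : ℂ, X / (-1/4 - w/4) = X * (2 * (-1/4 + w/4)) := by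
    intro X; rw [div_eq_iff z1]; linear_combination (-2 * X) * c1
  have v2 : ∀ X : ℂ, X / (-1/4 + w/4) = X * (2 * (-1/4 - w/4)) := by
    intro X; rw [div_eq_iff z2]; linear_combination (-2 * X) * c1
  have c3 : (1 - (-1/4 - w/4):ℂ) * (1 - (-1/4 + w/4):ℂ) = 2 := by linear_combination (-1/16) * hw
  have y1 : (1 - (-1/4 - w/4):ℂ) ≠ 0 := by intro h; rw [h] at c3; norm_num at c3
  have y2 : (1 - (-1/4 + w/4):ℂ) ≠ 0 := by intro h; rw [h] at c3; norm_num at c3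
  have v3 : ∀ X : ℂ, X / (1 - (-1/4 - w/4)) = X * ((1 - (-1/4 + w/4)) / 2) := by
    intro X; rw [div_eq_iff y1]; linear_combination (-X/2) * c3
  have v4 : ∀ X : ℂ, X / (1 - (-1/4 + w/4)) = X * ((1 - (-1/4 - w/4)) / 2) := by
    intro X; rw [div_eq_iff y2]; linear_combination (-X/2) * c3
  rw [v1, v2, v3, v4]
  push_cast
  have hI : Complex.I ^ 2 = -1 := Complex.I_sq
  generalize (Real.log 2 : ℂ) = L
  generalize (Real.arctan (Real.sqrt 7 / 5) : ℂ) = T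
  generalize ((Real.sqrt 7 : ℝ) : ℂ) = s at *
  generalize Complex.I = i at *
  clear * - hw hwdef h7 hI
  subst hwdef
  grind

theorem stmt_19 :
    ∑' k : ℕ, ((harmonic (2 * k) : ℝ) - (harmonic k : ℝ)) * (-1) ^ k * k /
        ((3 * k + 1) * (Nat.choose (3 * k) k : ℝ) * 4 ^ (k + 1)) =
      (3 / 448) * Real.log 2 - (9 / 512) * (Real.log 2) ^ 2 -
        (3 / 128) * (Real.arctan (Real.sqrt 7 / 5)) ^ 2 -
        ((1 / 224) - (89 / 6272) * Real.log 2) * Real.sqrt 7 *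
          Real.arctan (Real.sqrt 7 / 5) := by
  rw [sum_eq, final]
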